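/- The set Y = ρ⁻¹(G₁^c) = {x ∈ X₁ : for every prime p, the omitted residue class (g_x)_p is not ≡ 1 mod p²} is a Borel subset of X and is recurrent for the shift, i.e. Y ⊆ ⋃_{n=1}^∞ σ^{−n} Y. -/

import Mathlib

open MeasureTheory Filter Set
open scoped ENNReal Classical

noncomputable section

/-- The sequence space `{0,1}^{ℕ*}`; index `n : ℕ` represents the positive integer `n + 1`. -/
abbrev Omega2 : Type := ℕ → Bool

/-- The left shift `(σ x)_n = x_{n+1}`. -/
def shift : Omega2 → Omega2 := fun x n => x (n + 1)

/-- `x` omits the residue class `a` modulo `q` (the position of index `n` is `n + 1`). -/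
def OmitsMod (x : Omega2) (q : ℕ) (a : ZMod q) : Prop :=
  ∀ n : ℕ, ((n + 1 : ℕ) : ZMod q) = a → x n = false

/-- The squarefree flow: sequences whose support omits at least one residue class
modulo `p ^ 2` for every prime `p`. -/
def SqfFlow : Set Omega2 :=
  {x | ∀ p : Nat.Primes, ∃ a : ZMod ((p : ℕ) ^ 2), OmitsMod x ((p : ℕ) ^ 2) a}

instance (p : Nat.Primes) : NeZero ((p : ℕ) ^ 2) := ⟨pow_ne_zero 2 p.2.ne_zero⟩
instance (n : ℕ) : MeasurableSpace (ZMod n) := ⊤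
instance (n : ℕ) : TopologicalSpace (ZMod n) := ⊥
instance (n : ℕ) : DiscreteTopology (ZMod n) := ⟨rfl⟩

/-- The group `G = ∏_p ℤ/p²ℤ`. -/
abbrev G : Type := ∀ p : Nat.Primes, ZMod ((p : ℕ) ^ 2)

/-- Translation by `(-1, -1, -1, …)` on `G`. -/
def T1 : G → G := fun g p => g p - 1

/-- `G₁ = {g : g_p ≡ 1 mod p² for some prime p}`. -/
def G1 : Set G := {g | ∃ p : Nat.Primes, g p = 1}

/-- Shannon entropy of the finite partition of `α` induced by `f`. -/
def partH {α β : Type*} [MeasurableSpace α] [Fintype β] (μ : Measure α) (f : α → β) : ℝ :=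
  ∑ b : β, Real.negMulLog ((μ (f ⁻¹' {b})).toReal)

/-- Entropy of the process generated by the observable `f` under `T`. -/
def procH {α : Type*} [MeasurableSpace α] (μ : Measure α) (T : α → α)
    {k : ℕ} (f : α → Fin k) : ℝ :=
  ⨅ n : ℕ, partH μ (fun x (i : Fin (n + 1)) => f (T^[(i : ℕ)] x)) / (n + 1)

/-- Kolmogorov–Sinai entropy of `T` with respect to `μ`: supremum over finite measurable
partitions (encoded as finite-valued measurable observables). -/
def ksEntropy {α : Type*} [MeasurableSpace α] (μ : Measure α) (T : α → α) : EReal :=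
  ⨆ (k : ℕ) (f : α → Fin k) (_ : Measurable f), ((procH μ T f : ℝ) : EReal)

/-- First return time (`0` if the point never returns). -/
def retTime {α : Type*} (T : α → α) (Y : Set α) (x : α) : ℕ :=
  sInf {n : ℕ | 0 < n ∧ T^[n] x ∈ Y}

/-- Induced (first–return) transformation, as a map of the ambient space. -/
def inducedAmb {α : Type*} (T : α → α) (Y : Set α) (x : α) : α :=
  T^[retTime T Y x] x

/-- Number of omitted residue classes modulo `q`. -/
def numOmitted (x : Omega2) (q : ℕ) : ℕ := Set.ncard {a : ZMod q | OmitsMod x q a}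

/-- `x` is persistent modulo `q`: every residue class meeting the support meets it infinitely. -/
def Persistent (x : Omega2) (q : ℕ) : Prop :=
  ∀ a : ZMod q, (∃ n : ℕ, ((n + 1 : ℕ) : ZMod q) = a ∧ x n = true) →
    {n : ℕ | ((n + 1 : ℕ) : ZMod q) = a ∧ x n = true}.Infinite

/-- The set of `p`-persistent sequences in the squarefree flow. -/
def SP (p : Nat.Primes) : Set Omega2 := {x ∈ SqfFlow | Persistent x ((p : ℕ) ^ 2)}

/-- `X_I`: sequences omitting exactly `I p` classes mod `p²` and persistent for every `p`. -/
def XI (I : Nat.Primes → ℕ) : Set Omega2 :=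
  {x ∈ SqfFlow | (∀ p : Nat.Primes, numOmitted x ((p : ℕ) ^ 2) = I p) ∧
    ∀ p : Nat.Primes, Persistent x ((p : ℕ) ^ 2)}

/-- `X₁ = X_{(1,1,1,…)}`. -/
def X1 : Set Omega2 := XI fun _ => 1

/-- `ρ(x)_p` is the (unique, for `x ∈ X₁`) omitted residue class mod `p²`. -/
def rho (x : Omega2) : G := fun p =>
  if h : ∃ a : ZMod ((p : ℕ) ^ 2), OmitsMod x ((p : ℕ) ^ 2) a then h.choose else 0

/-- `Y = ρ⁻¹(G₁ᶜ) ⊆ X₁`. -/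
def Y : Set Omega2 := {x ∈ X1 | rho x ∈ G1ᶜ}

/-- `α_g(m) = #{1 ≤ n ≤ m : n ≡ g_p mod p² for some prime p}`. -/
def alphaG (g : G) (m : ℕ) : ℕ :=
  Set.ncard {n : ℕ | 1 ≤ n ∧ n ≤ m ∧ ∃ p : Nat.Primes, ((n : ℕ) : ZMod ((p : ℕ) ^ 2)) = g p}

/-- The insertion map `ι : G × Ω⁽²⁾ → X`; position of index `n` is `m = n + 1`, and the
`1`-based value `y_{m - α_g(m)}` is the `0`-based entry `y (n - α_g(n+1))`. -/
def iota (g : G) (y : Omega2) : Omega2 := fun n =>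
  if ∃ p : Nat.Primes, ((n + 1 : ℕ) : ZMod ((p : ℕ) ^ 2)) = g p then false
  else y (n - alphaG g (n + 1))

/-- The skew product `T(g,y) = (T₁ g, σ^{ψ(g)} y)`, `ψ = 1 - 1_{G₁}`. -/
def skewT : G × Omega2 → G × Omega2 := fun gy =>
  if gy.1 ∈ G1 then (T1 gy.1, gy.2) else (T1 gy.1, shift gy.2)

/-- `G₁ᶜ × Ω⁽²⁾` as a subset of `G × Ω⁽²⁾`. -/
def ZSet : Set (G × Omega2) := G1ᶜ ×ˢ (Set.univ : Set Omega2)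

/-- `x̂`: delete from `x` the entries at positions congruent to `(g_x)_p` mod `p²` for some `p`. -/
def hat (x : Omega2) : Omega2 := fun m =>
  x (Nat.nth (fun j => ¬ ∃ p : Nat.Primes, ((j + 1 : ℕ) : ZMod ((p : ℕ) ^ 2)) = rho x p) m)

/-- A Haar probability measure on `G`: a translation-invariant Borel probability measure. -/
def IsHaarLike (m : Measure G) : Prop :=
  IsProbabilityMeasure m ∧ ∀ g : G, MeasurePreserving (fun h => g + h) m m

/-- The `(1/2, 1/2)` Bernoulli measure on `Ω⁽²⁾`, characterized by its cylinder values. -/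
def IsBernoulliHalf (ω : Measure Omega2) : Prop :=
  IsProbabilityMeasure ω ∧
    ∀ (s : Finset ℕ) (v : ℕ → Bool), ω {x | ∀ i ∈ s, x i = v i} = (1 / 2 : ℝ≥0∞) ^ s.card

/-- Normalized restriction of a measure on `G` to `G₁ᶜ`. -/
def mbar (m : Measure G) : Measure G := (m G1ᶜ)⁻¹ • m.restrict G1ᶜ

/-- The `k`-th prime (`0`-indexed), as an element of `Nat.Primes`. -/
def nthPrime (k : ℕ) : Nat.Primes := ⟨Nat.nth Nat.Prime k, Nat.prime_nth_prime k⟩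

/-- `X(r)`: sequences omitting at least one class mod `p_i²` for the first `r` primes. -/
def Xr (r : ℕ) : Set Omega2 :=
  {x | ∀ k : Fin r, ∃ a : ZMod ((nthPrime k : ℕ) ^ 2), OmitsMod x ((nthPrime k : ℕ) ^ 2) a}

/-- `X_I(r)`: elements of `X(r)` omitting exactly `I k` classes mod `p_k²` for `k ≤ r`. -/
def XIr (r : ℕ) (I : Fin r → ℕ) : Set Omega2 :=
  {x ∈ Xr r | ∀ k : Fin r, numOmitted x ((nthPrime k : ℕ) ^ 2) = I k}

/-- Number of distinct words of length `L` occurring in elements of `F`. -/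
def wordCount (F : Set Omega2) (L : ℕ) : ℕ :=
  Set.ncard {w : Fin L → Bool | ∃ x ∈ F, ∃ j : ℕ, ∀ t : Fin L, w t = x (j + (t : ℕ))}

/-- `α_g^r(m)`, counting only the first `r` primes. -/
def alphaGr (r : ℕ) (g : G) (m : ℕ) : ℕ :=
  Set.ncard {n : ℕ | 1 ≤ n ∧ n ≤ m ∧
    ∃ k : Fin r, ((n : ℕ) : ZMod ((nthPrime k : ℕ) ^ 2)) = g (nthPrime k)}

/-- The partial insertion map `ι_r`. -/
def iotaR (r : ℕ) (g : G) (y : Omega2) : Omega2 := fun n =>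
  if ∃ k : Fin r, ((n + 1 : ℕ) : ZMod ((nthPrime k : ℕ) ^ 2)) = g (nthPrime k) then false
  else y (n - alphaGr r g (n + 1))


theorem mem_X1_iff {x : Omega2} :
    x ∈ X1 ↔ ∀ p : Nat.Primes, (∃ a, ∀ b, OmitsMod x ((p : ℕ) ^ 2) b ↔ b = a) ∧
      Persistent x ((p : ℕ) ^ 2) := by
  have key : ∀ p : Nat.Primes, numOmitted x ((p : ℕ) ^ 2) = 1 ↔
      ∃ a, ∀ b, OmitsMod x ((p : ℕ) ^ 2) b ↔ b = a := by
    intro p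
    simp only [numOmitted, Set.ncard_eq_one, Set.ext_iff, Set.mem_ofPred_eq, Set.mem_singleton_iff]
  constructor
  · rintro ⟨-, h, hp⟩ p
    exact ⟨(key p).1 (h p), hp p⟩
  · intro h
    refine ⟨fun p => ?_, fun p => (key p).2 (h p).1, fun p => (h p).2⟩
    obtain ⟨a, ha⟩ := (h p).1
    exact ⟨a, (ha a).2 rfl⟩

theorem rho_eq_of_omitsMod_iff {x : Omega2} {p : Nat.Primes} {a : ZMod ((p : ℕ) ^ 2)}
    (h : ∀ b, OmitsMod x ((p : ℕ) ^ 2) b ↔ b = a) : rho x p = a := by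
  have hex : ∃ b, OmitsMod x ((p : ℕ) ^ 2) b := ⟨a, (h a).2 rfl⟩
  rw [rho, dif_pos hex]
  exact (h _).1 hex.choose_spec

theorem mem_Y_iff {x : Omega2} :
    x ∈ Y ↔ ∀ p : Nat.Primes, (∃ a, ∀ b, OmitsMod x ((p : ℕ) ^ 2) b ↔ b = a) ∧
      Persistent x ((p : ℕ) ^ 2) ∧ ¬ OmitsMod x ((p : ℕ) ^ 2) 1 := by
  have key : x ∈ Y ↔ x ∈ X1 ∧ ∀ p : Nat.Primes, rho x p ≠ 1 := by
    simp [Y, G1]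
  rw [key, mem_X1_iff, ← forall_and]
  refine forall_congr' fun p => ?_
  rw [and_assoc]
  refine and_congr_right ?_
  rintro ⟨a, ha⟩
  rw [rho_eq_of_omitsMod_iff ha, ha, ne_comm]

theorem measurable_omitsMod (q : ℕ) (a : ZMod q) :
    Measurable fun x : Omega2 => OmitsMod x q a := by
  unfold OmitsMod
  exact .forall fun n => measurable_const.imp <|
    measurableSet_setOfPred.1 (measurableSet_eq_fun (measurable_pi_apply n) measurable_const)

theorem measurable_persistent (q : ℕ) [NeZero q] :
    Measurable fun x : Omega2 => Persistent x q := by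
  have hn : ∀ (a : ZMod q) (n : ℕ),
      Measurable fun x : Omega2 => ((n + 1 : ℕ) : ZMod q) = a ∧ x n = true := fun a n =>
    measurable_const.and <|
      measurableSet_setOfPred.1 (measurableSet_eq_fun (measurable_pi_apply n) measurable_const)
  simp only [Persistent, ← Nat.frequently_atTop_iff_infinite, frequently_atTop]
  exact .forall fun a => .imp (.exists fun n => hn a n)
    (.forall fun N => .exists fun n => measurable_const.and (hn a n))

theorem measurableSet_Y : MeasurableSet Y := by
  have h : Y = {x | ∀ p : Nat.Primes, (∃ a, ∀ b, OmitsMod x ((p : ℕ) ^ 2) b ↔ b = a) ∧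
      Persistent x ((p : ℕ) ^ 2) ∧ ¬ OmitsMod x ((p : ℕ) ^ 2) 1} := Set.ext fun _ => mem_Y_iff
  rw [h, measurableSet_setOfPred]
  refine .forall fun p => .and ?_ ((measurable_persistent _).and (measurable_omitsMod _ _).not)
  exact .exists fun a => .forall fun b => (measurable_omitsMod _ b).iff measurable_const

theorem shift_iterate_apply (x : Omega2) (n k : ℕ) : shift^[n] x k = x (k + n) := by
  induction n generalizing k with
  | zero => rfl
  | succ n ih =>
    rw [Function.iterate_succ_apply', shift, ih]
    congr 1
    ring

/-- A class meeting the support of a persistent sequence meets it beyond any given index. -/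
theorem Persistent.exists_shift_iterate {x : Omega2} {q : ℕ} (hx : Persistent x q)
    {a : ZMod q} (ha : ¬ OmitsMod x q a) (n N : ℕ) :
    ∃ m, N < m ∧ ((m + 1 : ℕ) : ZMod q) = a - n ∧ shift^[n] x m = true := by
  simp only [OmitsMod, not_forall, Bool.not_eq_false] at ha
  obtain ⟨k, hk, hxk⟩ := ha
  obtain ⟨m, ⟨hma, hm⟩, hlt⟩ := (hx a ⟨k, hk, hxk⟩).exists_gt (N + n)
  refine ⟨m - n, by omega, ?_, ?_⟩
  · rw [← hma, eq_sub_iff_add_eq, ← Nat.cast_add]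
    congr 1
    omega
  · rw [shift_iterate_apply, Nat.sub_add_cancel (by omega), hm]

theorem OmitsMod.shift_iterate {x : Omega2} {q : ℕ} {a : ZMod q} (h : OmitsMod x q a) (n : ℕ) :
    OmitsMod (shift^[n] x) q (a - n) := by
  intro k hk
  rw [shift_iterate_apply]
  refine h _ ?_
  rw [eq_sub_iff_add_eq] at hk
  rw [← hk]
  push_cast
  ring

theorem Persistent.omitsMod_shift_iterate_iff {x : Omega2} {q : ℕ} (hx : Persistent x q)
    (n : ℕ) (b : ZMod q) : OmitsMod (shift^[n] x) q b ↔ OmitsMod x q (b + n) := by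
  constructor
  · intro h
    by_contra hb
    obtain ⟨m, -, hm, hxm⟩ := hx.exists_shift_iterate hb n 0
    rw [add_sub_cancel_right] at hm
    simp [h m hm] at hxm
  · intro h
    simpa using h.shift_iterate n

theorem Persistent.shift_iterate {x : Omega2} {q : ℕ} (hx : Persistent x q) (n : ℕ) :
    Persistent (shift^[n] x) q := by
  rintro b ⟨k, hk, hxk⟩
  have hb : ¬ OmitsMod x q (b + n) := by
    rw [← hx.omitsMod_shift_iterate_iff]
    intro h
    simp [h k hk] at hxk
  refine Set.infinite_of_forall_exists_gt fun N => ?_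
  obtain ⟨m, hlt, hm, hxm⟩ := hx.exists_shift_iterate hb n N
  exact ⟨m, ⟨by rwa [add_sub_cancel_right] at hm, hxm⟩, hlt⟩

theorem shift_iterate_mem_Y {x : Omega2} (hx : x ∈ X1) {n : ℕ} (hn : x n = true) :
    shift^[n] x ∈ Y := by
  rw [mem_Y_iff]
  intro p
  obtain ⟨⟨a, ha⟩, hp⟩ := mem_X1_iff.1 hx p
  refine ⟨⟨a - n, fun b => ?_⟩, hp.shift_iterate n, fun h => ?_⟩
  · rw [hp.omitsMod_shift_iterate_iff, ha, eq_sub_iff_add_eq]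
  · rw [hp.omitsMod_shift_iterate_iff] at h
    have := h n (by push_cast; ring)
    simp [hn] at this

/-- The set `Y = ρ⁻¹(G₁ᶜ) = {x ∈ X₁ : (g_x)_p ≢ 1 mod p² for all p}` is a
Borel subset of `X`, and it is recurrent for the shift: `Y ⊆ ⋃_{n ≥ 1} σ⁻ⁿ Y`. -/
theorem Y_borel_recurrent :
    Y ⊆ SqfFlow ∧ MeasurableSet Y ∧ ∀ x ∈ Y, ∃ n : ℕ, 1 ≤ n ∧ shift^[n] x ∈ Y := by
  refine ⟨fun x hx => hx.1.1, measurableSet_Y, fun x hx => ?_⟩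
  obtain ⟨-, hp, h1⟩ := mem_Y_iff.1 hx ⟨2, Nat.prime_two⟩
  obtain ⟨n, hlt, -, hn⟩ := hp.exists_shift_iterate h1 0 0
  exact ⟨n, hlt, shift_iterate_mem_Y hx.1 hn⟩

end
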